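/- Let M be an L-structure, A ⊆ M, and suppose M is strongly homogeneous over A. Let p and q be complete types over A and C a correspondence over A between p(M) and q(M). Then C is uniform. Moreover, each ≡_A-class C_i = {(x,y) ∈ C : (x,y) ≡_A (a_i,b_i)} of C is itself a uniform correspondence over A between p(M) and q(M), and if there is m ∈ ℚ such that every such class has ratio m_{C_i} = m, then m_C = m. -/

import Mathlib

open FirstOrder Set

namespace Unimod

universe u v w

variable (L : FirstOrder.Language.{u, v}) {M : Type w} [L.Structure M]

/-- Two tuples (indexed by `α`) satisfy the same `L`-formulas with parameters from `A`,
i.e. they have the same complete type over `A`. -/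
def SameType (A : Set M) {α : Type*} (a b : α → M) : Prop :=
  ∀ φ : L.Formula (↥A ⊕ α),
    φ.Realize (Sum.elim (fun x => (x : M)) a) ↔ φ.Realize (Sum.elim (fun x => (x : M)) b)

/-- The set of realizations of the complete type of the tuple `a` over `A`. -/
def typeSet (A : Set M) {α : Type*} (a : α → M) : Set (α → M) :=
  {b | SameType L A a b}

/-- A set is type-definable over `A` if it is an intersection of a family of `A`-definable
sets. -/
def TypeDefinable (A : Set M) {α : Type*} (s : Set (α → M)) : Prop :=
  ∃ S : Set (Set (α → M)), (∀ t ∈ S, A.Definable L t) ∧ s = ⋂₀ S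

/-- View a set of pairs of tuples as a set of `Fin n ⊕ Fin m`-indexed tuples. -/
def pairSet {M : Type w} {n m : ℕ} (C : Set ((Fin n → M) × (Fin m → M))) :
    Set ((Fin n ⊕ Fin m) → M) :=
  {v | (v ∘ Sum.inl, v ∘ Sum.inr) ∈ C}

/-- A correspondence over `A` between `X ⊆ M^n` and `Y ⊆ M^m`: a nonempty subset of `X × Y`,
type-definable over `A`, all of whose fibres and cofibres are finite. -/
structure IsCorrespondence (A : Set M) {n m : ℕ} (X : Set (Fin n → M)) (Y : Set (Fin m → M))
    (C : Set ((Fin n → M) × (Fin m → M))) : Prop where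
  nonempty : C.Nonempty
  subset : C ⊆ X ×ˢ Y
  typeDefinable : TypeDefinable L A (pairSet C)
  finite_fibers : ∀ x ∈ X, {y | (x, y) ∈ C}.Finite
  finite_cofibers : ∀ y ∈ Y, {x | (x, y) ∈ C}.Finite

/-- A uniform correspondence over `A` with constant fibre size `k` and cofibre size `ℓ`. -/
structure IsUniformCorrespondence (A : Set M) {n m : ℕ} (X : Set (Fin n → M))
    (Y : Set (Fin m → M)) (C : Set ((Fin n → M) × (Fin m → M))) (k ℓ : ℕ)
    extends IsCorrespondence L A X Y C : Prop where
  k_pos : 0 < k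
  l_pos : 0 < ℓ
  fiber_card : ∀ x ∈ X, {y | (x, y) ∈ C}.ncard = k
  cofiber_card : ∀ y ∈ Y, {x | (x, y) ∈ C}.ncard = ℓ

/-- A type-definable set `X` is measurable over `A` if every uniform correspondence over `A`
between `X` and itself is balanced. -/
def MeasurableOver (A : Set M) {n : ℕ} (X : Set (Fin n → M)) : Prop :=
  ∀ (C : Set ((Fin n → M) × (Fin n → M))) (k ℓ : ℕ),
    IsUniformCorrespondence L A X X C k ℓ → k = ℓ

/-- `X` and `Y` are commensurable over `A`, with common ratio `r`. -/
def CommensurableOverWithRatio (A : Set M) {n m : ℕ} (X : Set (Fin n → M))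
    (Y : Set (Fin m → M)) (r : ℚ) : Prop :=
  (∃ C k ℓ, IsUniformCorrespondence L A X Y C k ℓ) ∧
    ∀ C k ℓ, IsUniformCorrespondence L A X Y C k ℓ → (k : ℚ) / (ℓ : ℚ) = r

/-- `X` and `Y` are commensurable over `A`: there is a uniform correspondence over `A` between
them, and all such have the same ratio. -/
def CommensurableOver (A : Set M) {n m : ℕ} (X : Set (Fin n → M)) (Y : Set (Fin m → M)) : Prop :=
  ∃ r : ℚ, CommensurableOverWithRatio L A X Y r

/-- `M` is strongly homogeneous over `A`: any two tuples with the same type over `A` are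
conjugate by an automorphism of `M` fixing `A` pointwise. -/
def StronglyHomogeneousOver (A : Set M) : Prop :=
  ∀ (n : ℕ) (a b : Fin n → M), SameType L A a b →
    ∃ σ : M ≃[L] M, (∀ x ∈ A, σ x = x) ∧ ∀ i, σ (a i) = b i

/-- `M` is unimodular (with respect to the cardinal bound `κ` on parameter sets):
whenever `a ≡_A b` are interalgebraic over `A`, then `m(a/A ∪ b) = m(b/A ∪ a)`. -/
def Unimodular (κ : Cardinal.{w}) : Prop :=
  ∀ A : Set M, Cardinal.mk A < κ → ∀ (n : ℕ) (a b : Fin n → M),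
    SameType L A a b →
    (typeSet L (A ∪ Set.range b) a).Finite →
    (typeSet L (A ∪ Set.range a) b).Finite →
    (typeSet L (A ∪ Set.range b) a).ncard = (typeSet L (A ∪ Set.range a) b).ncard

/-- `M` is `κ`-saturated: every finitely satisfiable set of formulas in finitely many free
variables with parameters from a set of size `< κ` is realized in `M`. -/
def Saturated (κ : Cardinal.{w}) : Prop :=
  ∀ A : Set M, Cardinal.mk A < κ →
    ∀ (n : ℕ) (T : Set (L.Formula (↥A ⊕ Fin n))),
      (∀ T₀ : Finset (L.Formula (↥A ⊕ Fin n)), ↑T₀ ⊆ T →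
        ∃ v : Fin n → M, ∀ φ ∈ T₀, φ.Realize (Sum.elim (fun x => (x : M)) v)) →
      ∃ v : Fin n → M, ∀ φ ∈ T, φ.Realize (Sum.elim (fun x => (x : M)) v)

/-- A function `f : X → Y` is relatively definable over `A` if its graph is the intersection
of an `A`-definable set with `X × Y`. -/
def RelativelyDefinableFn (A : Set M) {n m : ℕ} (X : Set (Fin n → M)) (Y : Set (Fin m → M))
    (f : (Fin n → M) → (Fin m → M)) : Prop :=
  ∃ D : Set ((Fin n ⊕ Fin m) → M), A.Definable L D ∧
    ∀ x ∈ X, ∀ y ∈ Y, (Sum.elim x y ∈ D ↔ f x = y)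

/-- The `≡_A`-class of the pair `c`. -/
def pairClass (A : Set M) {n m : ℕ} (c : (Fin n → M) × (Fin m → M)) :
    Set ((Fin n → M) × (Fin m → M)) :=
  {p | SameType L A (Sum.elim c.1 c.2) (Sum.elim p.1 p.2)}

/-- A complete correspondence over `A`: a correspondence which is a single `≡_A`-class. -/
def IsCompleteCorrespondence (A : Set M) {n m : ℕ} (X : Set (Fin n → M)) (Y : Set (Fin m → M))
    (C : Set ((Fin n → M) × (Fin m → M))) : Prop :=
  IsCorrespondence L A X Y C ∧ ∃ c ∈ C, C = pairClass L A c


section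

variable {L}

theorem SameType.refl (A : Set M) {α : Type*} (v : α → M) : SameType L A v v :=
  fun _ => Iff.rfl

theorem SameType.symm {A : Set M} {α : Type*} {v w : α → M} (h : SameType L A v w) :
    SameType L A w v :=
  fun φ => (h φ).symm

theorem SameType.trans {A : Set M} {α : Type*} {u v w : α → M} (h : SameType L A u v)
    (h' : SameType L A v w) : SameType L A u w :=
  fun φ => (h φ).trans (h' φ)

theorem SameType.of_equiv {A : Set M} {α : Type*} (σ : M ≃[L] M) (hσ : ∀ x ∈ A, σ x = x)
    (v : α → M) : SameType L A v (σ ∘ v) := by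
  intro φ
  rw [← Language.StrongHomClass.realize_formula σ φ, Sum.comp_elim]
  have : (σ ∘ fun x : A => (x : M)) = fun x : A => (x : M) := funext fun x => hσ x x.2
  rw [this]

theorem TypeDefinable.mem_of_sameType {A : Set M} {α : Type*} {s : Set (α → M)}
    (hs : TypeDefinable L A s) {v w : α → M} (h : SameType L A v w) (hv : v ∈ s) : w ∈ s := by
  obtain ⟨S, hS, rfl⟩ := hs
  intro t ht
  obtain ⟨φ, rfl⟩ := Set.definable_iff_exists_formula_sum.1 (hS t ht)
  exact (h φ).1 (hv _ ht)

theorem typeDefinable_typeSet (A : Set M) {α : Type*} (v : α → M) :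
    TypeDefinable L A (typeSet L A v) := by
  refine ⟨{t | A.Definable L t ∧ v ∈ t}, fun t ht => ht.1, Set.Subset.antisymm ?_ ?_⟩
  · rintro w hw t ⟨ht, hv⟩
    obtain ⟨φ, rfl⟩ := Set.definable_iff_exists_formula_sum.1 ht
    exact (hw φ).1 hv
  · intro w hw φ
    refine ⟨fun hv => hw {u | φ.Realize (Sum.elim (fun x => (x : M)) u)}
      ⟨Set.definable_iff_exists_formula_sum.2 ⟨φ, rfl⟩, hv⟩, fun h => ?_⟩
    by_contra hv
    exact hw {u | φ.not.Realize (Sum.elim (fun x => (x : M)) u)}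
      ⟨Set.definable_iff_exists_formula_sum.2 ⟨φ.not, rfl⟩, hv⟩ h

variable {A : Set M} {n m : ℕ}

theorem pairClass_eq_iff {c d : (Fin n → M) × (Fin m → M)} :
    pairClass L A d = pairClass L A c ↔ d ∈ pairClass L A c := by
  refine ⟨fun h => h ▸ SameType.refl A _, fun h => Set.ext fun p => ?_⟩
  exact ⟨fun hp => SameType.trans h hp, fun hp => SameType.trans (SameType.symm h) hp⟩

theorem pairSet_pairClass (c : (Fin n → M) × (Fin m → M)) :
    pairSet (pairClass L A c) = typeSet L A (Sum.elim c.1 c.2) := by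
  ext v
  simp only [pairSet, pairClass, typeSet, Set.mem_ofPred_eq, Sum.elim_comp_inl_inr]

variable {C : Set ((Fin n → M) × (Fin m → M))}

theorem TypeDefinable.mem_of_mem_pairClass (hC : TypeDefinable L A (pairSet C))
    {c d : (Fin n → M) × (Fin m → M)} (hc : c ∈ C) (hd : d ∈ pairClass L A c) : d ∈ C :=
  hC.mem_of_sameType (v := Sum.elim c.1 c.2) (w := Sum.elim d.1 d.2) hd hc

theorem TypeDefinable.map_mem (hC : TypeDefinable L A (pairSet C)) (σ : M ≃[L] M)
    (hσ : ∀ x ∈ A, σ x = x) {x : Fin n → M} {y : Fin m → M} (h : (x, y) ∈ C) :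
    (σ ∘ x, σ ∘ y) ∈ C := by
  refine hC.mem_of_mem_pairClass h ?_
  have := SameType.of_equiv σ hσ (Sum.elim x y)
  rwa [Sum.comp_elim] at this

theorem StronglyHomogeneousOver.exists_equiv (hhom : StronglyHomogeneousOver L A)
    {x x' : Fin n → M} (h : SameType L A x x') :
    ∃ σ : M ≃[L] M, (∀ z ∈ A, σ z = z) ∧ σ ∘ x = x' := by
  obtain ⟨σ, hσ, h⟩ := hhom n x x' h
  exact ⟨σ, hσ, funext h⟩

theorem comp_left_injective (σ : M ≃[L] M) {α : Type*} :
    Function.Injective fun y : α → M => σ ∘ y :=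
  σ.injective.comp_left

theorem ncard_fiber_le (hhom : StronglyHomogeneousOver L A)
    (hC : TypeDefinable L A (pairSet C)) {x x' : Fin n → M} (h : SameType L A x x')
    (hfin : {y | (x', y) ∈ C}.Finite) :
    {y | (x, y) ∈ C}.ncard ≤ {y | (x', y) ∈ C}.ncard := by
  obtain ⟨σ, hσ, rfl⟩ := hhom.exists_equiv h
  exact Set.ncard_le_ncard_of_injOn (fun y => σ ∘ y) (fun y hy => hC.map_mem σ hσ hy)
    (comp_left_injective σ).injOn hfin

theorem ncard_cofiber_le (hhom : StronglyHomogeneousOver L A)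
    (hC : TypeDefinable L A (pairSet C)) {y y' : Fin m → M} (h : SameType L A y y')
    (hfin : {x | (x, y') ∈ C}.Finite) :
    {x | (x, y) ∈ C}.ncard ≤ {x | (x, y') ∈ C}.ncard := by
  obtain ⟨σ, hσ, rfl⟩ := hhom.exists_equiv h
  exact Set.ncard_le_ncard_of_injOn (fun x => σ ∘ x) (fun x hx => hC.map_mem σ hσ hx)
    (comp_left_injective σ).injOn hfin

variable {a : Fin n → M} {b : Fin m → M}

theorem IsCorrespondence.isUniform (hhom : StronglyHomogeneousOver L A)
    (hC : IsCorrespondence L A (typeSet L A a) (typeSet L A b) C) :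
    ∃ k l, IsUniformCorrespondence L A (typeSet L A a) (typeSet L A b) C k l := by
  obtain ⟨⟨x, y⟩, hxy⟩ := hC.nonempty
  obtain ⟨hx, hy⟩ := hC.subset hxy
  refine ⟨{y' | (x, y') ∈ C}.ncard, {x' | (x', y) ∈ C}.ncard, hC,
    (Set.ncard_pos (hC.finite_fibers x hx)).2 ⟨y, hxy⟩,
    (Set.ncard_pos (hC.finite_cofibers y hy)).2 ⟨x, hxy⟩, fun x' hx' => ?_, fun y' hy' => ?_⟩
  · have h := SameType.trans (SameType.symm hx) hx'
    exact le_antisymm (ncard_fiber_le hhom hC.typeDefinable h.symm (hC.finite_fibers x hx))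
      (ncard_fiber_le hhom hC.typeDefinable h (hC.finite_fibers x' hx'))
  · have h := SameType.trans (SameType.symm hy) hy'
    exact le_antisymm (ncard_cofiber_le hhom hC.typeDefinable h.symm (hC.finite_cofibers y hy))
      (ncard_cofiber_le hhom hC.typeDefinable h (hC.finite_cofibers y' hy'))

theorem IsCorrespondence.pairClass {X : Set (Fin n → M)} {Y : Set (Fin m → M)}
    (hC : IsCorrespondence L A X Y C)
    {c : (Fin n → M) × (Fin m → M)} (hc : c ∈ C) :
    IsCorrespondence L A X Y (pairClass L A c) := by
  have hsub : Unimod.pairClass L A c ⊆ C :=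
    fun d hd => hC.typeDefinable.mem_of_mem_pairClass hc hd
  exact ⟨⟨c, SameType.refl A _⟩, hsub.trans hC.subset,
    pairSet_pairClass (L := L) (A := A) c ▸ typeDefinable_typeSet A _,
    fun x hx => (hC.finite_fibers x hx).subset fun y hy => hsub hy,
    fun y hy => (hC.finite_cofibers y hy).subset fun x hx => hsub hx⟩

theorem IsUniformCorrespondence.exists_mem_fiber {X : Set (Fin n → M)} {Y : Set (Fin m → M)}
    {k l : ℕ} (hC : IsUniformCorrespondence L A X Y C k l) {x : Fin n → M} (hx : x ∈ X) :
    ∃ y, (x, y) ∈ C :=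
  Set.nonempty_of_ncard_ne_zero (s := {y | (x, y) ∈ C}) (by
    rw [hC.fiber_card x hx]; exact hC.k_pos.ne')

theorem IsUniformCorrespondence.exists_mem_cofiber {X : Set (Fin n → M)} {Y : Set (Fin m → M)}
    {k l : ℕ} (hC : IsUniformCorrespondence L A X Y C k l) {y : Fin m → M} (hy : y ∈ Y) :
    ∃ x, (x, y) ∈ C :=
  Set.nonempty_of_ncard_ne_zero (s := {x | (x, y) ∈ C}) (by
    rw [hC.cofiber_card y hy]; exact hC.l_pos.ne')

/-- If all `≡_A`-classes in a uniform correspondence between complete types have ratio `r`, so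
does the correspondence: every class meets every fibre and cofibre, so both `k` and `l` are sums
over the same finite set of classes. -/
theorem IsUniformCorrespondence.ratio_eq (hhom : StronglyHomogeneousOver L A) {k l : ℕ}
    (hC : IsUniformCorrespondence L A (typeSet L A a) (typeSet L A b) C k l) {r : ℚ}
    (hr : ∀ c ∈ C, ∀ k' l',
      IsUniformCorrespondence L A (typeSet L A a) (typeSet L A b) (pairClass L A c) k' l' →
      (k' : ℚ) / (l' : ℚ) = r) :
    (k : ℚ) / (l : ℚ) = r := by
  classical
  have ha : a ∈ typeSet L A a := SameType.refl A a
  have hb : b ∈ typeSet L A b := SameType.refl A b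
  have hfin := hC.finite_fibers a ha
  have hcofin := hC.finite_cofibers b hb
  have hmem : ∀ {c d}, c ∈ C → d ∈ pairClass L A c → d ∈ C :=
    fun hc hd => hC.typeDefinable.mem_of_mem_pairClass hc hd
  set F := hfin.toFinset with hF
  set G := hcofin.toFinset with hG
  let f : (Fin m → M) → Set ((Fin n → M) × (Fin m → M)) := fun y => pairClass L A (a, y)
  let g : (Fin n → M) → Set ((Fin n → M) × (Fin m → M)) := fun x => pairClass L A (x, b)
  have himage : F.image f = G.image g := by
    ext s
    simp only [Finset.mem_image, hF, hG, Set.Finite.mem_toFinset, Set.mem_ofPred_eq]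
    constructor
    · rintro ⟨y, hy, rfl⟩
      obtain ⟨k', l', h⟩ := (hC.toIsCorrespondence.pairClass hy).isUniform hhom
      obtain ⟨x, hx⟩ := h.exists_mem_cofiber hb
      exact ⟨x, hmem hy hx, pairClass_eq_iff.2 hx⟩
    · rintro ⟨x, hx, rfl⟩
      obtain ⟨k', l', h⟩ := (hC.toIsCorrespondence.pairClass hx).isUniform hhom
      obtain ⟨y, hy⟩ := h.exists_mem_fiber ha
      exact ⟨y, hmem hx hy, pairClass_eq_iff.2 hy⟩
  have hk : k = ∑ s ∈ F.image f, (F.filter fun y => f y = s).card := by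
    rw [← Finset.card_eq_sum_card_image, hF, ← Set.ncard_eq_toFinset_card _ hfin,
      hC.fiber_card a ha]
  have hl : l = ∑ s ∈ F.image f, (G.filter fun x => g x = s).card := by
    rw [himage, ← Finset.card_eq_sum_card_image, hG, ← Set.ncard_eq_toFinset_card _ hcofin,
      hC.cofiber_card b hb]
  have hclass : ∀ s ∈ F.image f, ((F.filter fun y => f y = s).card : ℚ) =
      r * (G.filter fun x => g x = s).card := by
    intro s hs
    obtain ⟨z, hz, rfl⟩ := Finset.mem_image.1 hs
    have hz : (a, z) ∈ C := hfin.mem_toFinset.1 hz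
    obtain ⟨k', l', h⟩ := (hC.toIsCorrespondence.pairClass hz).isUniform hhom
    have h1 : (F.filter fun y => f y = f z).card = k' := by
      rw [← h.fiber_card a ha, ← Set.ncard_coe_finset]
      congr 1
      ext y
      simp only [Finset.coe_filter, hF, Set.Finite.mem_toFinset, Set.mem_ofPred_eq, f,
        pairClass_eq_iff]
      exact ⟨fun h => h.2, fun h => ⟨hmem hz h, h⟩⟩
    have h2 : (G.filter fun x => g x = f z).card = l' := by
      rw [← h.cofiber_card b hb, ← Set.ncard_coe_finset]
      congr 1
      ext x
      simp only [Finset.coe_filter, hG, Set.Finite.mem_toFinset, Set.mem_ofPred_eq, f, g,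
        pairClass_eq_iff]
      exact ⟨fun h => h.2, fun h => ⟨hmem hz h, h⟩⟩
    have hl' : (l' : ℚ) ≠ 0 := Nat.cast_ne_zero.2 h.l_pos.ne'
    rw [h1, h2, ← hr _ hz k' l' h, div_mul_cancel₀ _ hl']
  have hl0 : (l : ℚ) ≠ 0 := Nat.cast_ne_zero.2 hC.l_pos.ne'
  rw [div_eq_iff hl0, hk, hl, Nat.cast_sum, Nat.cast_sum, Finset.mul_sum]
  exact Finset.sum_congr rfl hclass

end

/-- A correspondence over `A` between complete types is automatically uniform,
each of its `≡_A`-classes is a uniform correspondence, and if all classes have the same ratio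
`r`, then the correspondence itself has ratio `r`. -/
theorem statement7 (L : FirstOrder.Language.{u, v}) (M : Type w) [L.Structure M]
    (A : Set M) (hhom : StronglyHomogeneousOver L A) (n m : ℕ)
    (a : Fin n → M) (b : Fin m → M)
    (C : Set ((Fin n → M) × (Fin m → M)))
    (hC : IsCorrespondence L A (typeSet L A a) (typeSet L A b) C) :
    (∃ k ℓ, IsUniformCorrespondence L A (typeSet L A a) (typeSet L A b) C k ℓ) ∧
    (∀ c ∈ C, ∃ k' ℓ',
      IsUniformCorrespondence L A (typeSet L A a) (typeSet L A b) (pairClass L A c) k' ℓ') ∧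
    (∀ r : ℚ,
      (∀ c ∈ C, ∀ k' ℓ',
        IsUniformCorrespondence L A (typeSet L A a) (typeSet L A b) (pairClass L A c) k' ℓ' →
        (k' : ℚ) / (ℓ' : ℚ) = r) →
      ∀ k ℓ, IsUniformCorrespondence L A (typeSet L A a) (typeSet L A b) C k ℓ →
        (k : ℚ) / (ℓ : ℚ) = r) := by
  exact ⟨hC.isUniform hhom, fun c hc => (hC.pairClass hc).isUniform hhom,
    fun r hr k ℓ h => h.ratio_eq hhom hr⟩

end Unimod
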